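/- Let W be a two-parameter Brownian motion on [0,1]² and f : ℝ → ℝ bounded and measurable. For n ≥ 1 regard Xⁿ as a function on [0,1]² and define its modulus of continuity w(Xⁿ,δ) := sup{ |Xⁿ_{(s,t)} − Xⁿ_{(s',t')}| : (s,t),(s',t') ∈ [0,1]², max(|s−s'|, |t−t'|) < δ }. Then for every ε > 0, lim_{δ → 0} limsup_{n → ∞} P[ w(Xⁿ, δ) ≥ ε ] = 0 (this is the tightness estimate for the sequence (Xⁿ) in the two-parameter Skorohod space). -/

import Mathlib

open MeasureTheory ProbabilityTheory Filter Topology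

/-- A two-parameter Brownian motion (Brownian sheet) on `[0,1]²`. -/
def IsBrownianSheet {Ω : Type*} [MeasurableSpace Ω] (P : Measure Ω)
    (W : ℝ × ℝ → Ω → ℝ) : Prop :=
  (∀ z, Measurable (W z)) ∧
  (∀ᵐ ω ∂P, Continuous fun z => W z ω) ∧
  ∀ (m : ℕ) (z : Fin m → ℝ × ℝ), (∀ k, z k ∈ Set.Icc ((0:ℝ), (0:ℝ)) (1, 1)) →
    ∀ c : Fin m → ℝ,
      Measure.map (fun ω => ∑ k, c k * W (z k) ω) P =
        gaussianReal 0 (Real.toNNReal (∑ k, ∑ k', c k * c k' *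
          (min (z k).1 (z k').1 * min (z k).2 (z k').2)))

/-- The weighted quadratic variations process. -/
noncomputable def wqv {Ω : Type*} (W : ℝ × ℝ → Ω → ℝ) (f : ℝ → ℝ) (n : ℕ)
    (s t : ℝ) (ω : Ω) : ℝ :=
  n * ∑ i ∈ Finset.Icc 1 (Nat.floor ((n : ℝ) * s)),
      ∑ j ∈ Finset.Icc 1 (Nat.floor ((n : ℝ) * t)),
    f (W (((i : ℝ) - 1) / n, ((j : ℝ) - 1) / n) ω) *
      ((W (((i : ℝ) - 1) / n, ((j : ℝ) - 1) / n) ω + W ((i : ℝ) / n, (j : ℝ) / n) ω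
          - W (((i : ℝ) - 1) / n, (j : ℝ) / n) ω
          - W ((i : ℝ) / n, ((j : ℝ) - 1) / n) ω) ^ 2
        - 1 / (n : ℝ) ^ 2)

/-- Modulus of continuity of a function on `[0,1]²`:
`w(F,δ) = sup { |F(s,t) - F(s',t')| : (s,t),(s',t') ∈ [0,1]², max(|s-s'|,|t-t'|) < δ }`. -/
noncomputable def modCont (F : ℝ × ℝ → ℝ) (δ : ℝ) : ℝ :=
  ⨆ q : {q : (ℝ × ℝ) × (ℝ × ℝ) // q.1 ∈ Set.Icc ((0:ℝ), (0:ℝ)) (1, 1) ∧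
      q.2 ∈ Set.Icc ((0:ℝ), (0:ℝ)) (1, 1) ∧
      max |q.1.1 - q.2.1| |q.1.2 - q.2.2| < δ},
    |F q.val.1 - F q.val.2|

section MaximalInequality

variable {Ω : Type*} [mΩ : MeasurableSpace Ω] {P : Measure Ω}

/-- Monomials of total degree at most four in two `L⁴` functions are integrable. -/
lemma MeasureTheory.MemLp.integrable_pow_mul_pow [IsFiniteMeasure P] {x y : Ω → ℝ}
    (hx : MemLp x 4 P) (hy : MemLp y 4 P) {a b : ℕ} (hab : a + b ≤ 4) :
    Integrable (fun ω => x ω ^ a * y ω ^ b) P := by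
  have hx4 : Integrable (fun ω => ‖x ω‖ ^ 4) P := hx.integrable_norm_pow (by norm_num)
  have hy4 : Integrable (fun ω => ‖y ω‖ ^ 4) P := hy.integrable_norm_pow (by norm_num)
  refine Integrable.mono' (((integrable_const (1 : ℝ)).add hx4).add hy4)
    ((hx.1.pow a).mul (hy.1.pow b)) (Eventually.of_forall fun ω => ?_)
  simp only [Pi.add_apply, norm_mul, norm_pow]
  set t := max 1 (max ‖x ω‖ ‖y ω‖) with ht
  have h1 : 1 ≤ t := le_max_left _ _
  have hxt : ‖x ω‖ ≤ t := (le_max_left _ _).trans (le_max_right _ _)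
  have hyt : ‖y ω‖ ≤ t := (le_max_right _ _).trans (le_max_right _ _)
  have hx0 := norm_nonneg (x ω)
  have hy0 := norm_nonneg (y ω)
  calc ‖x ω‖ ^ a * ‖y ω‖ ^ b ≤ t ^ a * t ^ b := by gcongr
    _ = t ^ (a + b) := (pow_add _ _ _).symm
    _ ≤ t ^ 4 := pow_le_pow_right₀ h1 hab
    _ ≤ 1 + ‖x ω‖ ^ 4 + ‖y ω‖ ^ 4 := by
      have hx4 := pow_nonneg hx0 4
      have hy4 := pow_nonneg hy0 4
      rcases max_choice 1 (max ‖x ω‖ ‖y ω‖) with h | h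
      · rw [ht, h]; linarith
      · rw [ht, h]
        rcases max_choice ‖x ω‖ ‖y ω‖ with h' | h' <;> rw [h'] <;> linarith

lemma MeasureTheory.MemLp.integrable_pow_four [IsFiniteMeasure P] {x : Ω → ℝ}
    (hx : MemLp x 4 P) : Integrable (fun ω => x ω ^ 4) P := by
  simpa using hx.integrable_pow_mul_pow hx (a := 4) (b := 0) le_rfl

lemma MeasureTheory.MemLp.partialSups {y : ℕ → Ω → ℝ} {p : ENNReal} (h : ∀ k, MemLp (y k) p P)
    (k : ℕ) : MemLp (partialSups y k) p P := by
  induction k with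
  | zero => simpa using h 0
  | succ k ih =>
    rw [partialSups_add_one]
    exact ih.sup (h _)

lemma MeasureTheory.StronglyAdapted.stronglyMeasurable_partialSups {y : ℕ → Ω → ℝ}
    {ℱ : Filtration ℕ mΩ} (h : StronglyAdapted ℱ y) (k : ℕ) :
    StronglyMeasurable[ℱ k] (_root_.partialSups y k) := by
  induction k with
  | zero => simpa using h 0
  | succ k ih =>
    rw [partialSups_add_one]
    exact @StronglyMeasurable.sup _ _ _ _ (ℱ (k + 1)) _ _ _ (ih.mono (ℱ.mono (Nat.le_succ k)))
      (h (k + 1))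

lemma MeasureTheory.Submartingale.integral_mul_sub_nonneg [IsFiniteMeasure P] {y : ℕ → Ω → ℝ}
    {ℱ : Filtration ℕ mΩ} (hy : Submartingale y ℱ P) {Z : Ω → ℝ} {k : ℕ}
    (hZ : StronglyMeasurable[ℱ k] Z) (hZ0 : 0 ≤ Z)
    (hint : Integrable (Z * (y (k + 1) - y k)) P) :
    0 ≤ ∫ ω, Z ω * (y (k + 1) ω - y k ω) ∂P := by
  have hsub : Integrable (y (k + 1) - y k) P := (hy.integrable _).sub (hy.integrable _)
  have h1 := condExp_mul_of_stronglyMeasurable_left hZ hint hsub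
  have h2 := hy.condExp_sub_nonneg (Nat.le_succ k)
  have h3 : ∫ ω, Z ω * (y (k + 1) ω - y k ω) ∂P =
      ∫ ω, (P[Z * (y (k + 1) - y k) | ℱ k]) ω ∂P := by
    rw [integral_condExp (ℱ.le k)]
    rfl
  rw [h3]
  refine integral_nonneg_of_ae ?_
  filter_upwards [h1, h2] with ω h1 h2
  rw [h1]
  exact mul_nonneg (hZ0 ω) h2

/-- **Doob's maximal inequality** in `L⁴`. -/
theorem MeasureTheory.Submartingale.integral_partialSups_pow_four_le [IsFiniteMeasure P]
    {y : ℕ → Ω → ℝ} {ℱ : Filtration ℕ mΩ} (hy : Submartingale y ℱ P) (h0 : ∀ k, 0 ≤ y k)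
    (h4 : ∀ k, MemLp (y k) 4 P) (N : ℕ) :
    ∫ ω, (partialSups y N ω) ^ 4 ∂P ≤ 4 * ∫ ω, y N ω ^ 4 ∂P := by
  have hm4 := MemLp.partialSups h4
  have hm0 : ∀ k, 0 ≤ partialSups y k := fun k => (h0 k).trans (le_partialSups y k)
  have hi3 : ∀ k l, Integrable (fun ω => partialSups y k ω ^ 3 * y l ω) P := fun k l => by
    simpa using (hm4 k).integrable_pow_mul_pow (h4 l) (a := 3) (b := 1) le_rfl
  have key : ∀ k, ∫ ω, (3 * partialSups y k ω ^ 4 - 4 * (partialSups y k ω ^ 3 * y k ω)) ∂P ≤ 0 := by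
    intro k
    induction k with
    | zero =>
      refine integral_nonpos fun ω => ?_
      have : 0 ≤ y 0 ω ^ 4 := pow_nonneg (h0 0 ω) 4
      simp only [partialSups_zero, Pi.zero_apply]
      nlinarith
    | succ k ih =>
      have hmono : ∀ ω, 3 * partialSups y (k + 1) ω ^ 4
          - 4 * (partialSups y (k + 1) ω ^ 3 * y (k + 1) ω) ≤
          (3 * partialSups y k ω ^ 4 - 4 * (partialSups y k ω ^ 3 * y k ω))
            - 4 * (partialSups y k ω ^ 3 * (y (k + 1) ω - y k ω)) := by
        intro ω
        rw [partialSups_add_one, Pi.sup_apply]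
        rcases le_total (y (k + 1) ω) (partialSups y k ω) with h | h
        · rw [sup_eq_left.2 h]
          apply le_of_eq; ring
        · rw [sup_eq_right.2 h]
          set u := y (k + 1) ω
          set v := partialSups y k ω
          have hu : 0 ≤ u := h0 _ ω
          have hv : 0 ≤ v := hm0 k ω
          have := mul_nonneg (sq_nonneg (u - v))
            (by positivity : 0 ≤ u ^ 2 + 2 * u * v + 3 * v ^ 2)
          nlinarith
      have hdiff : Integrable (fun ω => partialSups y k ω ^ 3 * (y (k + 1) ω - y k ω)) P := by
        simp only [mul_sub]
        exact (hi3 k (k + 1)).sub (hi3 k k)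
      have hZ : ∀ k, Integrable
          (fun ω => 3 * partialSups y k ω ^ 4 - 4 * (partialSups y k ω ^ 3 * y k ω)) P :=
        fun k => ((hm4 k).integrable_pow_four.const_mul 3).sub ((hi3 k k).const_mul 4)
      have hpos := hy.integral_mul_sub_nonneg (Z := fun ω => partialSups y k ω ^ 3)
        ((hy.stronglyAdapted.stronglyMeasurable_partialSups k).pow 3)
        (fun ω => pow_nonneg (hm0 k ω) 3) hdiff
      have := integral_mono (hZ (k + 1)) ((hZ k).sub (hdiff.const_mul 4)) hmono
      rw [integral_sub' (hZ k) (hdiff.const_mul 4), integral_const_mul] at this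
      linarith
  have hk := key N
  rw [integral_sub ((hm4 N).integrable_pow_four.const_mul 3) ((hi3 N N).const_mul 4),
    integral_const_mul, integral_const_mul] at hk
  have hyoung : ∫ ω, 4 * (partialSups y N ω ^ 3 * y N ω) ∂P ≤
      ∫ ω, (2 * partialSups y N ω ^ 4 + 4 * y N ω ^ 4) ∂P := by
    refine integral_mono ((hi3 N N).const_mul 4)
      (((hm4 N).integrable_pow_four.const_mul 2).add ((h4 N).integrable_pow_four.const_mul 4))
      fun ω => ?_
    simp only
    set u := y N ω
    set v := partialSups y N ω
    have hu : 0 ≤ u := h0 N ω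
    have hv : 0 ≤ v := hm0 N ω
    nlinarith [sq_nonneg (v ^ 2 - v * u), sq_nonneg (v * u - 2 * u ^ 2), sq_nonneg (v ^ 2 - u ^ 2),
      sq_nonneg (v ^ 2 - v * u - u ^ 2), sq_nonneg (v * u - u ^ 2)]
  rw [integral_add ((hm4 N).integrable_pow_four.const_mul 2)
    ((h4 N).integrable_pow_four.const_mul 4), integral_const_mul, integral_const_mul,
    integral_const_mul] at hyoung
  linarith

end MaximalInequality

section PredictableArray

variable {Ω ι : Type*} [mΩ : MeasurableSpace Ω] {P : Measure Ω}

/-- A finite array of independent centered innovations `η p` with bounded second and fourth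
moments, and bounded weights `F p` which only depend on the innovations `q` of smaller level
`c q < c p`. -/
structure IsPredictableArray (P : Measure Ω) (𝓜 : ι → MeasurableSpace Ω) (c : ι → ℕ)
    (F η : ι → Ω → ℝ) (C K : ℝ) : Prop where
  le : ∀ p, 𝓜 p ≤ mΩ
  indep : iIndep 𝓜 P
  stronglyMeasurable_innovation : ∀ p, StronglyMeasurable[𝓜 p] (η p)
  memLp_innovation : ∀ p, MemLp (η p) 4 P
  integral_innovation : ∀ p, ∫ ω, η p ω ∂P = 0
  integral_sq_le : ∀ p, ∫ ω, η p ω ^ 2 ∂P ≤ K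
  integral_pow_four_le : ∀ p, ∫ ω, η p ω ^ 4 ∂P ≤ K
  stronglyMeasurable_weight : ∀ p, StronglyMeasurable[⨆ q ∈ {q | c q < c p}, 𝓜 q] (F p)
  abs_weight_le : ∀ p ω, |F p ω| ≤ C

namespace IsPredictableArray

variable {𝓜 : ι → MeasurableSpace Ω} {c : ι → ℕ} {F η : ι → Ω → ℝ} {C K : ℝ}

lemma iSup_le (h : IsPredictableArray P 𝓜 c F η C K) (S : Set ι) : ⨆ q ∈ S, 𝓜 q ≤ mΩ :=
  iSup₂_le fun q _ => h.le q

lemma stronglyMeasurable_term (h : IsPredictableArray P 𝓜 c F η C K) {p : ι} {S : Set ι}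
    (hp : p ∈ S) (hS : ∀ q, c q < c p → q ∈ S) :
    StronglyMeasurable[⨆ q ∈ S, 𝓜 q] (fun ω => F p ω * η p ω) :=
  StronglyMeasurable.mul ((h.stronglyMeasurable_weight p).mono (biSup_mono hS))
    ((h.stronglyMeasurable_innovation p).mono (le_iSup₂_of_le p hp le_rfl))

lemma memLp_term [IsFiniteMeasure P] (h : IsPredictableArray P 𝓜 c F η C K) (p : ι) :
    MemLp (fun ω => F p ω * η p ω) 4 P :=
  (h.memLp_innovation p).of_le_mul (c := C)
    (((h.stronglyMeasurable_weight p).mono (h.iSup_le _)).aestronglyMeasurable.mul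
      (h.memLp_innovation p).1)
    (Eventually.of_forall fun ω => by
      rw [norm_mul]
      exact mul_le_mul_of_nonneg_right (h.abs_weight_le p ω) (norm_nonneg _))

lemma memLp_sum [IsFiniteMeasure P] (h : IsPredictableArray P 𝓜 c F η C K) (A : Finset ι) :
    MemLp (fun ω => ∑ p ∈ A, F p ω * η p ω) 4 P :=
  memLp_finsetSum A fun p _ => h.memLp_term p

/-- The natural filtration of the levels. -/
def filtration (h : IsPredictableArray P 𝓜 c F η C K) : Filtration ℕ mΩ where
  seq l := ⨆ q ∈ {q | c q < l}, 𝓜 q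
  mono' _ _ hkl := biSup_mono fun _ hq => lt_of_lt_of_le hq hkl
  le' _ := h.iSup_le _

lemma condExp_term [IsProbabilityMeasure P] (h : IsPredictableArray P 𝓜 c F η C K) (p : ι) :
    P[fun ω => F p ω * η p ω | h.filtration (c p)] =ᵐ[P] 0 := by
  have h1 : P[F p * η p | h.filtration (c p)] =ᵐ[P] F p * P[η p | h.filtration (c p)] :=
    condExp_mul_of_stronglyMeasurable_left (h.stronglyMeasurable_weight p)
      ((h.memLp_term p).integrable (by norm_num)) ((h.memLp_innovation p).integrable (by norm_num))
  have hind : Indep (⨆ q ∈ ({p} : Set ι), 𝓜 q) (h.filtration (c p)) P :=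
    indep_iSup_of_disjoint h.le h.indep (by simp)
  simp only [Set.mem_singleton_iff, iSup_iSup_eq_left] at hind
  have h2 : P[η p | h.filtration (c p)] =ᵐ[P] fun _ => P[η p] :=
    condExp_indep_eq (h.le p) (h.filtration.le _) (h.stronglyMeasurable_innovation p) hind
  filter_upwards [h1, h2] with ω h1 h2
  refine h1.trans ?_
  rw [Pi.mul_apply, h2, h.integral_innovation p, mul_zero, Pi.zero_apply]

/-- Summation up to a given level is a martingale. -/
lemma martingale_sum [IsProbabilityMeasure P] (h : IsPredictableArray P 𝓜 c F η C K)
    (A : Finset ι) :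
    Martingale (fun l ω => ∑ p ∈ A with c p < l, F p ω * η p ω) h.filtration P := by
  refine martingale_of_condExp_sub_eq_zero_nat (fun l => ?_)
    (fun l => (h.memLp_sum _).integrable (by norm_num)) fun l => ?_
  · refine Finset.stronglyMeasurable_fun_sum _ fun p hp => ?_
    have hp := (Finset.mem_filter.1 hp).2
    exact h.stronglyMeasurable_term hp fun q hq => hq.trans hp
  · classical
    have hdiff : (fun ω => ∑ p ∈ A with c p < l + 1, F p ω * η p ω)
        - (fun ω => ∑ p ∈ A with c p < l, F p ω * η p ω)
        = ∑ p ∈ A with c p = l, fun ω => F p ω * η p ω := by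
      ext ω
      rw [Pi.sub_apply, Finset.sum_apply, sub_eq_iff_eq_add, ← Finset.sum_union]
      · congr 1
        ext p
        simp only [Finset.mem_filter, Finset.mem_union, ← and_or_left]
        exact and_congr_right fun _ => by omega
      · refine Finset.disjoint_filter.2 fun p _ h1 h2 => by omega
    rw [hdiff]
    refine (condExp_finsetSum (fun p _ => (h.memLp_term p).integrable (by norm_num)) _).trans ?_
    have : ∀ᵐ ω ∂P, ∀ p ∈ A.filter (fun p => c p = l),
        (P[fun ω => F p ω * η p ω | h.filtration l]) ω = 0 := by
      refine (Finset.eventually_all _).2 fun p hp => ?_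
      have := h.condExp_term p
      rw [(Finset.mem_filter.1 hp).2] at this
      exact this
    filter_upwards [this] with ω hω
    rw [Finset.sum_apply, Finset.sum_eq_zero hω, Pi.zero_apply]

lemma integral_mul_pow [IsProbabilityMeasure P] (h : IsPredictableArray P 𝓜 c F η C K) {p : ι}
    {x : Ω → ℝ} (hx : StronglyMeasurable[⨆ q ∈ ({p}ᶜ : Set ι), 𝓜 q] x) (k : ℕ) :
    ∫ ω, x ω * η p ω ^ k ∂P = (∫ ω, x ω ∂P) * ∫ ω, η p ω ^ k ∂P := by
  have hind : Indep (⨆ q ∈ ({p}ᶜ : Set ι), 𝓜 q) (⨆ q ∈ ({p} : Set ι), 𝓜 q) P :=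
    indep_iSup_of_disjoint h.le h.indep disjoint_compl_left
  simp only [Set.mem_singleton_iff, iSup_iSup_eq_left] at hind
  have hη := (h.stronglyMeasurable_innovation p).pow k
  refine IndepFun.integral_fun_mul_eq_mul_integral
    (indep_of_indep_of_le_left (indep_of_indep_of_le_right hind ?_) ?_)
    ((hx.mono (h.iSup_le _)).aestronglyMeasurable) ((hη.mono (h.le p)).aestronglyMeasurable)
  · exact hη.measurable.comap_le
  · exact hx.measurable.comap_le

/-- The second and fourth moments of weighted sums of innovations. -/
lemma integral_sum_pow_le [IsProbabilityMeasure P] (h : IsPredictableArray P 𝓜 c F η C K)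
    (A : Finset ι) :
    ∫ ω, (∑ p ∈ A, F p ω * η p ω) ^ 2 ∂P ≤ C ^ 2 * K * A.card ∧
    ∫ ω, (∑ p ∈ A, F p ω * η p ω) ^ 4 ∂P ≤ C ^ 4 * (8 * K ^ 2 + 3 * K) * (A.card : ℝ) ^ 2 := by
  classical
  induction A using Finset.induction_on_max_value c with
  | empty => simp
  | insert a s has hmax ih =>
    obtain ⟨ih2, ih4⟩ := ih
    set M : Ω → ℝ := fun ω => ∑ p ∈ s, F p ω * η p ω with hM
    have hK : 0 ≤ K := (integral_nonneg fun ω => sq_nonneg _).trans (h.integral_sq_le a)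
    have hMm : StronglyMeasurable[⨆ q ∈ ({a}ᶜ : Set ι), 𝓜 q] M := by
      refine Finset.stronglyMeasurable_fun_sum _ fun p hp => h.stronglyMeasurable_term ?_ ?_
      · rintro rfl; exact has hp
      · rintro q hq rfl; exact absurd (hmax p hp) (not_le.2 hq)
    have hFm : StronglyMeasurable[⨆ q ∈ ({a}ᶜ : Set ι), 𝓜 q] (F a) := by
      refine (h.stronglyMeasurable_weight a).mono (biSup_mono ?_)
      rintro q (hq : c q < c a) rfl
      exact lt_irrefl _ hq
    have hM4 : MemLp M 4 P := h.memLp_sum s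
    have hd4 : MemLp (fun ω => F a ω * η a ω) 4 P := h.memLp_term a
    have hη4 := h.memLp_innovation a
    have hcross : ∀ k, ∫ ω, M ω ^ k * (F a ω * η a ω) ∂P = 0 := fun k => by
      have := h.integral_mul_pow ((hMm.pow k).mul hFm) 1
      simp only [pow_one, h.integral_innovation a, mul_zero, Pi.mul_apply, Pi.pow_apply] at this
      simpa only [mul_assoc] using this
    have hsq : ∀ k, Even k → k ≤ 2 → ∫ ω, M ω ^ k * (F a ω * η a ω) ^ 2 ∂P ≤
        C ^ 2 * (∫ ω, M ω ^ k * η a ω ^ 2 ∂P) := fun k hk hk2 => by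
      rw [← integral_const_mul]
      refine integral_mono (hM4.integrable_pow_mul_pow hd4 (by omega))
        ((hM4.integrable_pow_mul_pow hη4 (by omega)).const_mul _) fun ω => ?_
      have hMk : 0 ≤ M ω ^ k := hk.pow_nonneg _
      have hF : F a ω ^ 2 ≤ C ^ 2 := by
        rw [← sq_abs]
        exact pow_le_pow_left₀ (abs_nonneg _) (h.abs_weight_le a ω) 2
      simp only
      calc M ω ^ k * (F a ω * η a ω) ^ 2 = F a ω ^ 2 * (M ω ^ k * η a ω ^ 2) := by ring
        _ ≤ C ^ 2 * (M ω ^ k * η a ω ^ 2) := by gcongr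
    have hd2 : ∫ ω, (F a ω * η a ω) ^ 2 ∂P ≤ C ^ 2 * K := by
      have h1 := hsq 0 Even.zero (Nat.zero_le 2)
      simp only [pow_zero, one_mul] at h1
      exact h1.trans (mul_le_mul_of_nonneg_left (h.integral_sq_le a) (sq_nonneg C))
    have hMd2 : ∫ ω, M ω ^ 2 * (F a ω * η a ω) ^ 2 ∂P ≤ C ^ 4 * K ^ 2 * s.card := by
      have h1 := hsq 2 even_two le_rfl
      have h2 := h.integral_mul_pow (hMm.pow 2) 2
      simp only [Pi.pow_apply] at h2
      rw [h2] at h1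
      have h3 : (∫ ω, M ω ^ 2 ∂P) * ∫ ω, η a ω ^ 2 ∂P ≤ (C ^ 2 * K * s.card) * K :=
        mul_le_mul ih2 (h.integral_sq_le a) (integral_nonneg fun ω => sq_nonneg _) (by positivity)
      calc _ ≤ _ := h1
        _ ≤ C ^ 2 * ((C ^ 2 * K * s.card) * K) := mul_le_mul_of_nonneg_left h3 (sq_nonneg C)
        _ = _ := by ring
    have hd4' : ∫ ω, (F a ω * η a ω) ^ 4 ∂P ≤ C ^ 4 * K := by
      refine le_trans ?_ (mul_le_mul_of_nonneg_left (h.integral_pow_four_le a)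
        (by positivity : 0 ≤ C ^ 4))
      rw [← integral_const_mul]
      refine integral_mono hd4.integrable_pow_four (hη4.integrable_pow_four.const_mul _) fun ω => ?_
      have hF : F a ω ^ 4 ≤ C ^ 4 := by
        have := pow_le_pow_left₀ (abs_nonneg _) (h.abs_weight_le a ω) 4
        rwa [Even.pow_abs (by decide)] at this
      simp only [mul_pow]
      gcongr
    have hsum : ∀ ω, ∑ p ∈ insert a s, F p ω * η p ω = M ω + F a ω * η a ω := fun ω => by
      rw [Finset.sum_insert has, add_comm]
    have i2 {k l : ℕ} (hkl : k + l ≤ 4) : Integrable (fun ω => M ω ^ k * (F a ω * η a ω) ^ l) P :=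
      hM4.integrable_pow_mul_pow hd4 hkl
    have iM2 : Integrable (fun ω => M ω ^ 2) P := by
      simpa using i2 (k := 2) (l := 0) (by norm_num)
    have id2 : Integrable (fun ω => (F a ω * η a ω) ^ 2) P := by
      simpa using i2 (k := 0) (l := 2) (by norm_num)
    have iMd : Integrable (fun ω => M ω ^ 1 * (F a ω * η a ω)) P := by
      simpa using i2 (k := 1) (l := 1) (by norm_num)
    have iM3d : Integrable (fun ω => M ω ^ 3 * (F a ω * η a ω)) P := by
      simpa using i2 (k := 3) (l := 1) (by norm_num)
    have iMd2 : Integrable (fun ω => M ω ^ 2 * (F a ω * η a ω) ^ 2) P := i2 (by norm_num)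
    rw [Finset.card_insert_of_notMem has]
    push_cast
    simp only [hsum]
    constructor
    · have : ∀ ω, (M ω + F a ω * η a ω) ^ 2 =
          M ω ^ 2 + (2 * (M ω ^ 1 * (F a ω * η a ω)) + (F a ω * η a ω) ^ 2) := fun ω => by ring
      simp only [this]
      have iR : Integrable (fun ω => 2 * (M ω ^ 1 * (F a ω * η a ω)) + (F a ω * η a ω) ^ 2) P :=
        (iMd.const_mul 2).add id2
      rw [integral_add iM2 iR, integral_add (iMd.const_mul 2) id2,
        integral_const_mul, hcross 1]
      linarith
    · have hle : ∀ ω, (M ω + F a ω * η a ω) ^ 4 ≤ M ω ^ 4 + (4 * (M ω ^ 3 * (F a ω * η a ω)) +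
          (8 * (M ω ^ 2 * (F a ω * η a ω) ^ 2) + 3 * (F a ω * η a ω) ^ 4)) := fun ω => by
        nlinarith [mul_nonneg (sq_nonneg (F a ω * η a ω)) (sq_nonneg (M ω - F a ω * η a ω))]
      have iR3 := (iMd2.const_mul 8).add (hd4.integrable_pow_four.const_mul 3)
      have iR2 := (iM3d.const_mul 4).add iR3
      have := integral_mono (hM4.add hd4).integrable_pow_four
        (hM4.integrable_pow_four.add iR2) hle
      rw [integral_add' hM4.integrable_pow_four iR2, integral_add' (iM3d.const_mul 4) iR3,
        integral_add' (iMd2.const_mul 8) (hd4.integrable_pow_four.const_mul 3),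
        integral_const_mul, integral_const_mul, integral_const_mul, hcross 3] at this
      simp only [Pi.add_apply] at this
      have hs : (0 : ℝ) ≤ s.card := Nat.cast_nonneg _
      have hCK : 0 ≤ C ^ 4 * K ^ 2 * s.card := by positivity
      have hCK1 : 0 ≤ C ^ 4 * K * s.card := by positivity
      have hCK2 : 0 ≤ C ^ 4 * K ^ 2 := by positivity
      nlinarith

end IsPredictableArray

lemma MeasureTheory.Martingale.submartingale_abs {ℱ : Filtration ℕ mΩ} {f : ℕ → Ω → ℝ}
    (hf : Martingale f ℱ P) : Submartingale (fun k ω => |f k ω|) ℱ P :=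
  hf.submartingale.sup hf.neg.submartingale

lemma MeasureTheory.Submartingale.partialSups {ℱ : Filtration ℕ mΩ} {f : ℕ → ℕ → Ω → ℝ}
    (hf : ∀ k, Submartingale (f k) ℱ P) (k : ℕ) :
    Submartingale (fun l => _root_.partialSups (fun k => f k l) k) ℱ P := by
  induction k with
  | zero => simpa using hf 0
  | succ k ih =>
    simp only [partialSups_add_one]
    exact ih.sup (hf (k + 1))

namespace IsPredictableArray

variable {𝓜 : ι → MeasurableSpace Ω} {c₁ c₂ : ι → ℕ} {F η : ι → Ω → ℝ} {C K : ℝ}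

/-- A maximal inequality for two-parameter partial sums of weighted innovations. -/
theorem measure_exists_le_abs_sum [IsProbabilityMeasure P]
    (h₁ : IsPredictableArray P 𝓜 c₁ F η C K) (h₂ : IsPredictableArray P 𝓜 c₂ F η C K)
    (A : Finset ι) (k₀ l₀ : ℕ) {r : ℝ} (hr : 0 < r) :
    P {ω | ∃ k ≤ k₀, ∃ l ≤ l₀, r ≤ |∑ p ∈ A with c₁ p < k ∧ c₂ p < l, F p ω * η p ω|} ≤
      ENNReal.ofReal (16 * (C ^ 4 * (8 * K ^ 2 + 3 * K) * (A.card : ℝ) ^ 2) / r ^ 4) := by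
  set T : ℕ → ℕ → Ω → ℝ := fun k l ω => |∑ p ∈ A with c₁ p < k ∧ c₂ p < l, F p ω * η p ω|
    with hT
  have hT4 : ∀ k l, MemLp (T k l) 4 P := fun k l => (h₁.memLp_sum _).norm
  have hTl : ∀ k, Submartingale (T k) h₂.filtration P := fun k => by
    have := (h₂.martingale_sum (A.filter fun p => c₁ p < k)).submartingale_abs
    simpa only [Finset.filter_filter] using this
  have hTk : ∀ l, Submartingale (fun k => T k l) h₁.filtration P := fun l => by
    have := (h₁.martingale_sum (A.filter fun p => c₂ p < l)).submartingale_abs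
    simpa only [Finset.filter_filter, and_comm] using this
  have hT0 : ∀ k l, 0 ≤ T k l := fun k l ω => abs_nonneg _
  set Z : ℕ → Ω → ℝ := fun l => partialSups (fun k => T k l) k₀ with hZ
  have hZ4 : ∀ l, MemLp (Z l) 4 P := fun l => MemLp.partialSups (fun k => hT4 k l) k₀
  have hTZ : ∀ k ≤ k₀, ∀ l, T k l ≤ Z l := fun k hk l => le_partialSups_of_le (fun k => T k l) hk
  have hZ0 : ∀ l, 0 ≤ Z l := fun l => (hT0 0 l).trans (hTZ 0 (Nat.zero_le _) l)
  have hY4 := MemLp.partialSups hZ4 l₀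
  have e1 := (Submartingale.partialSups hTl k₀).integral_partialSups_pow_four_le hZ0 hZ4 l₀
  have e2 := (hTk l₀).integral_partialSups_pow_four_le (fun k => hT0 k l₀) (fun k => hT4 k l₀) k₀
  have e3 : ∫ ω, T k₀ l₀ ω ^ 4 ∂P ≤ C ^ 4 * (8 * K ^ 2 + 3 * K) * (A.card : ℝ) ^ 2 := by
    simp only [hT, Even.pow_abs (by decide : Even 4)]
    have hcard : ((A.filter fun p => c₁ p < k₀ ∧ c₂ p < l₀).card : ℝ) ≤ A.card :=
      Nat.cast_le.2 (Finset.card_filter_le _ _)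
    rcases A.eq_empty_or_nonempty with rfl | ⟨a, -⟩
    · simp
    have hK : 0 ≤ K := (integral_nonneg fun ω => sq_nonneg _).trans (h₁.integral_sq_le a)
    refine (h₁.integral_sum_pow_le _).2.trans ?_
    gcongr
  have hmarkov := mul_meas_ge_le_integral_of_nonneg (μ := P)
    (f := fun ω => partialSups Z l₀ ω ^ 4) (Eventually.of_forall fun ω => by positivity)
    hY4.integrable_pow_four (r ^ 4)
  have hsub : {ω | ∃ k ≤ k₀, ∃ l ≤ l₀, r ≤ T k l ω} ⊆ {ω | r ^ 4 ≤ partialSups Z l₀ ω ^ 4} := by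
    rintro ω ⟨k, hk, l, hl, hω⟩
    have : r ≤ partialSups Z l₀ ω :=
      hω.trans ((hTZ k hk l ω).trans (le_partialSups_of_le Z hl ω))
    exact pow_le_pow_left₀ hr.le this 4
  refine (measure_mono hsub).trans ?_
  rw [← ofReal_measureReal]
  refine ENNReal.ofReal_le_ofReal ?_
  rw [le_div_iff₀ (by positivity)]
  linarith

end IsPredictableArray

end PredictableArray

section Blocks

lemma abs_sub_le_of_blocks {T : ℕ → ℝ} {n L : ℕ} {r : ℝ} (hL : 0 < L)
    (h : ∀ a ≤ n / L, ∀ k ≤ n, a * L ≤ k → k ≤ (a + 1) * L → |T k - T (a * L)| < r)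
    {k k' : ℕ} (hk' : k' ≤ n) (hkk' : k ≤ k') (hlt : k' < k + L) :
    |T k - T k'| ≤ 3 * r := by
  have hk : k ≤ n := hkk'.trans hk'
  have hdiv : k / L * L ≤ k := Nat.div_mul_le_self k L
  have hdiv' : k < (k / L + 1) * L := by
    rw [mul_comm]
    exact Nat.lt_mul_div_succ k hL
  have h1 := abs_lt.1 (h _ (Nat.div_le_div_right hk) k hk hdiv hdiv'.le)
  rw [abs_le]
  rcases le_or_gt k' ((k / L + 1) * L) with hle | hgt
  · have h2 := abs_lt.1 (h _ (Nat.div_le_div_right hk) k' hk' (hdiv.trans hkk') hle)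
    constructor <;> linarith
  · have h2 := abs_lt.1 (h _ (Nat.div_le_div_right hk) _ (hgt.le.trans hk')
      (Nat.mul_le_mul_right L (Nat.le_succ _)) le_rfl)
    have h3 := abs_lt.1 (h _ ((Nat.le_div_iff_mul_le hL).2 (hgt.le.trans hk')) k' hk' hgt.le (by
      rw [add_mul _ 1, one_mul]
      omega))
    constructor <;> linarith

lemma sum_filter_lt_sub_sum_filter_lt {ι : Type*} [Fintype ι] (c₁ c₂ : ι → ℕ) (g : ι → ℝ)
    {m k m' : ℕ} (l : ℕ) (hmk : m ≤ k) (hkm : k ≤ m') :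
    ∑ p with c₁ p < k ∧ c₂ p < l, g p - ∑ p with c₁ p < m ∧ c₂ p < l, g p =
      ∑ p ∈ Finset.univ.filter (fun p => m ≤ c₁ p ∧ c₁ p < m') with c₁ p < k ∧ c₂ p < l, g p := by
  rw [Finset.filter_filter, Finset.sum_filter, Finset.sum_filter, Finset.sum_filter,
    ← Finset.sum_sub_distrib]
  refine Finset.sum_congr rfl fun p _ => ?_
  by_cases h1 : c₂ p < l <;> by_cases h2 : c₁ p < m <;> by_cases h3 : c₁ p < k <;>
    simp [h1, h2, h3] <;> omega

/-- Maximal inequality for the oscillation of the partial sums of a predictable array in the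
first index, over windows of length less than `L`. -/
theorem IsPredictableArray.measure_exists_lt_abs_sum_sub {Ω ι : Type*} [MeasurableSpace Ω]
    {P : Measure Ω} [IsProbabilityMeasure P] [Fintype ι] {𝓜 : ι → MeasurableSpace Ω}
    {c₁ c₂ : ι → ℕ} {F η : ι → Ω → ℝ} {C K : ℝ}
    (h₁ : IsPredictableArray P 𝓜 c₁ F η C K) (h₂ : IsPredictableArray P 𝓜 c₂ F η C K)
    {n L M : ℕ} (hL : 0 < L) (hK : 0 ≤ K)
    (hM : ∀ a, (Finset.univ.filter fun p => a * L ≤ c₁ p ∧ c₁ p < (a + 1) * L).card ≤ M)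
    {r : ℝ} (hr : 0 < r) :
    P {ω | ∃ l ≤ n, ∃ k' ≤ n, ∃ k ≤ k', k' < k + L ∧
        3 * r < |∑ p with c₁ p < k ∧ c₂ p < l, F p ω * η p ω -
          ∑ p with c₁ p < k' ∧ c₂ p < l, F p ω * η p ω|} ≤
      ENNReal.ofReal (((n / L + 1 : ℕ) : ℝ) *
        (16 * (C ^ 4 * (8 * K ^ 2 + 3 * K) * (M : ℝ) ^ 2) / r ^ 4)) := by
  set S : ℕ → ℕ → Ω → ℝ := fun k l ω => ∑ p with c₁ p < k ∧ c₂ p < l, F p ω * η p ω with hS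
  set A : ℕ → Finset ι := fun a => Finset.univ.filter fun p => a * L ≤ c₁ p ∧ c₁ p < (a + 1) * L
    with hA
  set B : ℕ → Set Ω := fun a => {ω | ∃ k ≤ n, ∃ l ≤ n,
    r ≤ |∑ p ∈ A a with c₁ p < k ∧ c₂ p < l, F p ω * η p ω|} with hB
  have hsub : {ω | ∃ l ≤ n, ∃ k' ≤ n, ∃ k ≤ k', k' < k + L ∧ 3 * r < |S k l ω - S k' l ω|} ⊆
      ⋃ a ∈ Finset.range (n / L + 1), B a := by
    rintro ω ⟨l, hl, k', hk', k, hkk', hlt, hω⟩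
    by_contra hnot
    simp only [Set.mem_iUnion, Finset.mem_range, Nat.lt_succ_iff, hB, Set.mem_ofPred_eq, not_exists,
      not_and, not_le] at hnot
    refine hω.not_ge (abs_sub_le_of_blocks (T := fun k => S k l ω) hL ?_ hk' hkk' hlt)
    intro a ha k hk hak hka
    simp only [hS, sum_filter_lt_sub_sum_filter_lt c₁ c₂ (fun p => F p ω * η p ω) l hak hka]
    exact hnot a ha k hk l hl
  calc P {ω | ∃ l ≤ n, ∃ k' ≤ n, ∃ k ≤ k', k' < k + L ∧ 3 * r < |S k l ω - S k' l ω|}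
      ≤ ∑ a ∈ Finset.range (n / L + 1), P (B a) :=
        (measure_mono hsub).trans (measure_biUnion_finset_le _ _)
    _ ≤ ∑ _a ∈ Finset.range (n / L + 1),
        ENNReal.ofReal (16 * (C ^ 4 * (8 * K ^ 2 + 3 * K) * (M : ℝ) ^ 2) / r ^ 4) := by
      refine Finset.sum_le_sum fun a _ =>
        (h₁.measure_exists_le_abs_sum h₂ (A a) n n hr).trans (ENNReal.ofReal_le_ofReal ?_)
      have : ((A a).card : ℝ) ≤ M := by exact_mod_cast hM a
      gcongr
    _ ≤ _ := by
      rw [Finset.sum_const, Finset.card_range, nsmul_eq_mul, ENNReal.ofReal_mul (by positivity),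
        ENNReal.ofReal_natCast]

end Blocks

section GridIncrements

variable {Ω : Type*} [MeasurableSpace Ω] {P : Measure Ω} {W : ℝ × ℝ → Ω → ℝ}

lemma IsBrownianSheet.map_sum {κ : Type*} [Fintype κ] (hW : IsBrownianSheet P W)
    (z : κ → ℝ × ℝ) (hz : ∀ k, z k ∈ Set.Icc ((0:ℝ), (0:ℝ)) (1, 1)) (c : κ → ℝ) :
    Measure.map (fun ω => ∑ k, c k * W (z k) ω) P =
      gaussianReal 0 (Real.toNNReal (∑ k, ∑ k', c k * c k' *
        (min (z k).1 (z k').1 * min (z k).2 (z k').2))) := by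
  let e := (Fintype.equivFin κ).symm
  have h := hW.2.2 _ (z ∘ e) (fun k => hz _) (c ∘ e)
  simp only [Function.comp_apply] at h
  have h1 : ∀ ω, ∑ k, c (e k) * W (z (e k)) ω = ∑ k, c k * W (z k) ω := fun ω =>
    e.sum_comp fun k => c k * W (z k) ω
  have h2 : ∀ k, ∑ k', c k * c (e k') * (min (z k).1 (z (e k')).1 * min (z k).2 (z (e k')).2)
      = ∑ k', c k * c k' * (min (z k).1 (z k').1 * min (z k).2 (z k').2) := fun k =>
    e.sum_comp fun k' => c k * c k' * (min (z k).1 (z k').1 * min (z k).2 (z k').2)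
  simp only [h1, h2] at h
  rw [h]
  congr 2
  exact e.sum_comp fun k => ∑ k', c k * c k' * (min (z k).1 (z k').1 * min (z k).2 (z k').2)

lemma IsBrownianSheet.ae_eq_zero (hW : IsBrownianSheet P W) {z : ℝ × ℝ}
    (hz : z ∈ Set.Icc ((0:ℝ), (0:ℝ)) (1, 1)) (h0 : z.1 = 0 ∨ z.2 = 0) : ∀ᵐ ω ∂P, W z ω = 0 := by
  have h := hW.map_sum (κ := Unit) (fun _ => z) (fun _ => hz) (fun _ => 1)
  have h0' : z.1 * z.2 = 0 := mul_eq_zero.2 h0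
  simp only [Finset.univ_unique, Finset.sum_const, Finset.card_singleton, one_smul, one_mul,
    min_self, h0', Real.toNNReal_zero, gaussianReal_zero_var] at h
  have : ∀ᵐ x ∂(Measure.map (fun ω => W z ω) P), x = 0 := by
    rw [h]
    exact (ae_dirac_iff (p := fun x : ℝ => x = 0) (measurableSet_singleton 0)).2 rfl
  exact ae_of_ae_map (hW.1 z).aemeasurable this

/-- The increment of `W` over a cell of the grid of mesh `1 / n`. -/
noncomputable def cellIncrement (W : ℝ × ℝ → Ω → ℝ) (n : ℕ) (i j : ℕ) (ω : Ω) : ℝ :=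
  W ((i : ℝ) / n, (j : ℝ) / n) ω + W (((i : ℝ) + 1) / n, ((j : ℝ) + 1) / n) ω
    - W ((i : ℝ) / n, ((j : ℝ) + 1) / n) ω - W (((i : ℝ) + 1) / n, (j : ℝ) / n) ω

lemma measurable_cellIncrement (hW : IsBrownianSheet P W) (n i j : ℕ) :
    Measurable (cellIncrement W n i j) :=
  (((hW.1 _).add (hW.1 _)).sub (hW.1 _)).sub (hW.1 _)

lemma sum_sum_min_div (n i j : ℕ) :
    ∑ a : Fin 2, ∑ b : Fin 2, (-1 : ℝ) ^ (a : ℕ) * (-1) ^ (b : ℕ) *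
      min (((i : ℝ) + (a : ℕ)) / n) (((j : ℝ) + (b : ℕ)) / n) = if i = j then 1 / (n : ℝ) else 0 := by
  simp only [min_div_div_right (Nat.cast_nonneg n : (0 : ℝ) ≤ n), Fin.sum_univ_two, Fin.val_zero,
    Fin.val_one, Nat.cast_zero, Nat.cast_one, add_zero, pow_zero, pow_one]
  rcases lt_trichotomy i j with h | rfl | h
  · have h' : (i : ℝ) + 1 ≤ j := by exact_mod_cast h
    rw [if_neg h.ne, min_eq_left (by linarith), min_eq_left (by linarith),
      min_eq_left (by linarith), min_eq_left (by linarith)]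
    ring
  · rw [if_pos rfl, min_self, min_self, min_eq_left (by linarith), min_eq_right (by linarith)]
    ring
  · have h' : (j : ℝ) + 1 ≤ i := by exact_mod_cast h
    rw [if_neg h.ne', min_eq_right (by linarith), min_eq_right (by linarith),
      min_eq_right (by linarith), min_eq_right (by linarith)]
    ring

lemma IsBrownianSheet.map_sum_cellIncrement (hW : IsBrownianSheet P W) {n : ℕ}
    (c : Fin n × Fin n → ℝ) :
    Measure.map (fun ω => ∑ p, c p * cellIncrement W n p.1 p.2 ω) P =
      gaussianReal 0 (Real.toNNReal (∑ p, c p ^ 2 / (n : ℝ) ^ 2)) := by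
  have hmem : ∀ (i : Fin n) (a : Fin 2), ((i : ℕ) + (a : ℕ) : ℝ) / n ∈ Set.Icc (0 : ℝ) 1 := by
    intro i a
    have hn : (0 : ℝ) < n := Nat.cast_pos.2 i.pos
    refine ⟨by positivity, (div_le_one hn).2 ?_⟩
    have : (i : ℕ) + (a : ℕ) ≤ n := by omega
    exact_mod_cast this
  have h := hW.map_sum (κ := (Fin n × Fin n) × (Fin 2 × Fin 2))
    (fun x => ((((x.1.1 : ℕ) : ℝ) + (x.2.1 : ℕ)) / n, (((x.1.2 : ℕ) : ℝ) + (x.2.2 : ℕ)) / n))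
    (fun x => ⟨⟨(hmem _ _).1, (hmem _ _).1⟩, ⟨(hmem _ _).2, (hmem _ _).2⟩⟩)
    (fun x => c x.1 * ((-1) ^ (x.2.1 : ℕ) * (-1) ^ (x.2.2 : ℕ)))
  convert h using 2
  · ext ω
    refine Eq.trans ?_ (Fintype.sum_prod_type _).symm
    refine Finset.sum_congr rfl fun p _ => ?_
    simp only [Fintype.sum_prod_type, Fin.sum_univ_two, Fin.val_zero, Fin.val_one, Nat.cast_zero,
      Nat.cast_one, add_zero, pow_zero, pow_one, cellIncrement]
    ring
  · congr 1
    refine Eq.trans ?_ (Fintype.sum_prod_type _).symm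
    refine Finset.sum_congr rfl fun p _ => ?_
    refine Eq.trans ?_ (Finset.sum_congr rfl fun e _ => (Fintype.sum_prod_type _).symm)
    rw [Finset.sum_comm, Finset.sum_eq_single p]
    · have := congrArg₂ (· * ·) (sum_sum_min_div n p.1 p.1) (sum_sum_min_div n p.2 p.2)
      simp only [if_true] at this
      rw [div_eq_mul_one_div, show 1 / (n : ℝ) ^ 2 = 1 / n * (1 / n) by ring, ← this]
      simp only [Fintype.sum_prod_type, Fin.sum_univ_two]
      ring
    · intro q _ hq
      have h0 : (if (p.1 : ℕ) = q.1 then 1 / (n : ℝ) else 0) *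
          (if (p.2 : ℕ) = q.2 then 1 / (n : ℝ) else 0) = 0 := by
        by_contra hne
        have h1 := left_ne_zero_of_mul hne
        have h2 := right_ne_zero_of_mul hne
        rw [ne_eq, ite_eq_right_iff, Classical.not_imp] at h1 h2
        exact hq (Prod.ext (Fin.ext h1.1.symm) (Fin.ext h2.1.symm))
      rw [← sum_sum_min_div n p.1 q.1, ← sum_sum_min_div n p.2 q.2] at h0
      rw [← mul_zero (c p * c q), ← h0]
      simp only [Fintype.sum_prod_type, Fin.sum_univ_two]
      ring
    · simp

lemma IsBrownianSheet.map_cellIncrement (hW : IsBrownianSheet P W) {n : ℕ} (p : Fin n × Fin n) :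
    Measure.map (cellIncrement W n p.1 p.2) P = gaussianReal 0 (Real.toNNReal (1 / (n : ℝ) ^ 2)) := by
  have h := hW.map_sum_cellIncrement (Pi.single p 1)
  simpa [Pi.single_apply, ite_div, ← one_div] using h

lemma IsBrownianSheet.iIndepFun_cellIncrement [IsProbabilityMeasure P] (hW : IsBrownianSheet P W)
    (n : ℕ) : iIndepFun (fun (p : Fin n × Fin n) => cellIncrement W n p.1 p.2) P := by
  have hm : ∀ p : Fin n × Fin n, AEMeasurable (cellIncrement W n p.1 p.2) P :=
    fun p => (measurable_cellIncrement hW n p.1 p.2).aemeasurable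
  have hmm : AEMeasurable (fun ω => WithLp.toLp 2 fun p : Fin n × Fin n =>
      cellIncrement W n p.1 p.2 ω) P := by fun_prop
  rw [iIndepFun_iff_charFun_pi hm]
  intro t
  have h1 : charFun (P.map fun ω => WithLp.toLp 2 fun p : Fin n × Fin n =>
      cellIncrement W n p.1 p.2 ω) t =
      charFun (P.map fun ω => ∑ p, t p * cellIncrement W n p.1 p.2 ω) 1 := by
    rw [charFun_apply, charFun_apply_real, integral_map hmm
      (Continuous.aestronglyMeasurable (by fun_prop)), integral_map
      (Finset.aemeasurable_fun_sum _ fun p _ => (hm p).const_mul _)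
      (Continuous.aestronglyMeasurable (by fun_prop))]
    simp [PiLp.inner_apply]
  rw [h1, hW.map_sum_cellIncrement, charFun_gaussianReal]
  simp only [hW.map_cellIncrement, charFun_gaussianReal]
  rw [← Complex.exp_sum, Real.coe_toNNReal _ (by positivity), Real.coe_toNNReal _ (by positivity)]
  congr 1
  push_cast
  simp only [mul_zero, zero_mul, zero_sub, one_pow, mul_one, Finset.sum_neg_distrib,
    Finset.sum_div]
  congr 1
  refine Finset.sum_congr rfl fun p _ => ?_
  ring

lemma sum_range_cellIncrement {Ω : Type*} (W : ℝ × ℝ → Ω → ℝ) (n i j : ℕ) (ω : Ω) :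
    ∑ k ∈ Finset.range i, ∑ l ∈ Finset.range j, cellIncrement W n k l ω =
      W ((i : ℝ) / n, (j : ℝ) / n) ω - W ((i : ℝ) / n, 0) ω - W (0, (j : ℝ) / n) ω
        + W (0, 0) ω := by
  have h : ∀ k, ∑ l ∈ Finset.range j, cellIncrement W n k l ω =
      (W (((k + 1 : ℕ) : ℝ) / n, (j : ℝ) / n) ω - W (((k + 1 : ℕ) : ℝ) / n, 0) ω) -
        (W ((k : ℝ) / n, (j : ℝ) / n) ω - W ((k : ℝ) / n, 0) ω) := fun k => by
    have := Finset.sum_range_sub (fun l : ℕ => W (((k + 1 : ℕ) : ℝ) / n, (l : ℝ) / n) ω -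
      W ((k : ℝ) / n, (l : ℝ) / n) ω) j
    simp only [Nat.cast_zero, zero_div] at this
    rw [sub_sub_sub_comm, ← this]
    refine Finset.sum_congr rfl fun l _ => ?_
    simp only [cellIncrement, Nat.cast_add, Nat.cast_one]
    ring
  simp only [h]
  rw [Finset.sum_range_sub (fun k : ℕ => W ((k : ℝ) / n, (j : ℝ) / n) ω - W ((k : ℝ) / n, 0) ω)]
  simp only [Nat.cast_zero, zero_div]
  ring

lemma sum_filter_lt_and_lt {n i j : ℕ} (hi : i ≤ n) (hj : j ≤ n) (G : ℕ → ℕ → ℝ) :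
    ∑ p : Fin n × Fin n with (p.1 : ℕ) < i ∧ (p.2 : ℕ) < j, G p.1 p.2 =
      ∑ k ∈ Finset.range i, ∑ l ∈ Finset.range j, G k l := by
  have h : ∀ {m : ℕ}, m ≤ n → (Finset.range n).filter (· < m) = Finset.range m := fun hm => by
    ext k
    simp only [Finset.mem_filter, Finset.mem_range]
    omega
  rw [← h hi, ← h hj, Finset.sum_filter, Finset.sum_filter, Fintype.sum_prod_type,
    ← Fin.sum_univ_eq_sum_range fun k => if k < i then
      ∑ l ∈ (Finset.range n).filter (· < j), G k l else 0]
  refine Finset.sum_congr rfl fun k _ => ?_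
  rw [Finset.sum_filter, ← Fin.sum_univ_eq_sum_range fun l => if l < j then G k l else 0]
  by_cases hk : (k : ℕ) < i <;> simp [hk]

/-- The weight of a cell, as a function of the previous increments. -/
noncomputable def gridWeight (W : ℝ × ℝ → Ω → ℝ) (f : ℝ → ℝ) (n : ℕ) (p : Fin n × Fin n)
    (ω : Ω) : ℝ :=
  f (∑ q : Fin n × Fin n with (q.1 : ℕ) < p.1 ∧ (q.2 : ℕ) < p.2, cellIncrement W n q.1 q.2 ω)

/-- The normalized centered squared increment of a cell. -/
noncomputable def gridInnovation (W : ℝ × ℝ → Ω → ℝ) (n : ℕ) (p : Fin n × Fin n) (ω : Ω) : ℝ :=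
  (n * cellIncrement W n p.1 p.2 ω) ^ 2 - 1

/-- The sum of the weighted innovations over the cells below and to the left of `(k, l)`. -/
noncomputable def gridSum (W : ℝ × ℝ → Ω → ℝ) (f : ℝ → ℝ) (n k l : ℕ) (ω : Ω) : ℝ :=
  ∑ p : Fin n × Fin n with (p.1 : ℕ) < k ∧ (p.2 : ℕ) < l,
    gridWeight W f n p ω * gridInnovation W n p ω

lemma IsBrownianSheet.ae_eq_sum_cellIncrement (hW : IsBrownianSheet P W) {n : ℕ} (hn : 0 < n) :
    ∀ᵐ ω ∂P, ∀ i ≤ n, ∀ j ≤ n, W ((i : ℝ) / n, (j : ℝ) / n) ω =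
      ∑ k ∈ Finset.range i, ∑ l ∈ Finset.range j, cellIncrement W n k l ω := by
  have hn' : (0 : ℝ) < n := Nat.cast_pos.2 hn
  simp only [sum_range_cellIncrement, ae_all_iff]
  intro i hi j hj
  have hmem : ∀ {m : ℕ}, m ≤ n → (m : ℝ) / n ∈ Set.Icc (0 : ℝ) 1 := fun hm =>
    ⟨by positivity, (div_le_one hn').2 (by exact_mod_cast hm)⟩
  filter_upwards [hW.ae_eq_zero (z := ((i : ℝ) / n, 0)) ⟨⟨(hmem hi).1, le_rfl⟩,
      ⟨(hmem hi).2, zero_le_one⟩⟩ (Or.inr rfl),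
    hW.ae_eq_zero (z := (0, (j : ℝ) / n)) ⟨⟨le_rfl, (hmem hj).1⟩,
      ⟨zero_le_one, (hmem hj).2⟩⟩ (Or.inl rfl),
    hW.ae_eq_zero (z := (0, 0)) ⟨le_rfl, zero_le_one, zero_le_one⟩ (Or.inl rfl)]
    with ω h1 h2 h3
  rw [h1, h2, h3]
  ring

lemma floor_mul_le_of_mem_Icc {n : ℕ} {s : ℝ} (hs : s ∈ Set.Icc (0 : ℝ) 1) :
    ⌊(n : ℝ) * s⌋₊ ≤ n :=
  Nat.floor_le_of_le (mul_le_of_le_one_right (Nat.cast_nonneg n) hs.2)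

lemma IsBrownianSheet.ae_wqv_eq (hW : IsBrownianSheet P W) (f : ℝ → ℝ) {n : ℕ} (hn : 0 < n) :
    ∀ᵐ ω ∂P, ∀ s ∈ Set.Icc (0 : ℝ) 1, ∀ t ∈ Set.Icc (0 : ℝ) 1,
      wqv W f n s t ω = gridSum W f n ⌊(n : ℝ) * s⌋₊ ⌊(n : ℝ) * t⌋₊ ω / n := by
  have hn' : (n : ℝ) ≠ 0 := Nat.cast_ne_zero.2 hn.ne'
  filter_upwards [hW.ae_eq_sum_cellIncrement hn] with ω hω s hs t ht
  have hweight : ∀ p : Fin n × Fin n, gridWeight W f n p ω =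
      f (W (((p.1 : ℕ) : ℝ) / n, ((p.2 : ℕ) : ℝ) / n) ω) := fun p => by
    rw [gridWeight, hω _ p.1.2.le _ p.2.2.le, sum_filter_lt_and_lt p.1.2.le p.2.2.le
      fun k l => cellIncrement W n k l ω]
  rw [gridSum]
  simp only [hweight, gridInnovation]
  rw [sum_filter_lt_and_lt (floor_mul_le_of_mem_Icc hs) (floor_mul_le_of_mem_Icc ht) fun k l =>
      f (W ((k : ℝ) / n, (l : ℝ) / n) ω) * ((n * cellIncrement W n k l ω) ^ 2 - 1),
    wqv, eq_div_iff hn', Finset.mul_sum, Finset.sum_mul]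
  simp only [Finset.range_eq_Ico, Finset.mul_sum, Finset.sum_mul]
  have hIcc : ∀ (m : ℕ) (g : ℕ → ℝ), ∑ i ∈ Finset.Icc 1 m, g i = ∑ i ∈ Finset.Ico 0 m, g (i + 1) :=
    fun m g => by rw [Finset.sum_Ico_add' g 0 m 1, zero_add]; rfl
  simp only [hIcc]
  refine Finset.sum_congr rfl fun k _ => Finset.sum_congr rfl fun l _ => ?_
  simp only [cellIncrement, Nat.cast_add, Nat.cast_one, add_sub_cancel_right]
  field_simp

/-- A common bound of the second and fourth moments of the normalized innovations. -/
noncomputable def innovationBound : ℝ :=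
  max (∫ x, (x ^ 2 - 1) ^ 2 ∂gaussianReal 0 1) (∫ x, (x ^ 2 - 1) ^ 4 ∂gaussianReal 0 1)

lemma IsBrownianSheet.map_mul_cellIncrement (hW : IsBrownianSheet P W) {n : ℕ}
    (p : Fin n × Fin n) :
    Measure.map (fun ω => n * cellIncrement W n p.1 p.2 ω) P = gaussianReal 0 1 := by
  have hn' : (n : ℝ) ≠ 0 := Nat.cast_ne_zero.2 p.1.pos.ne'
  have h := Measure.map_map (μ := P) (measurable_const_mul (n : ℝ))
    (measurable_cellIncrement hW n p.1 p.2)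
  rw [Function.comp_def] at h
  rw [← h, hW.map_cellIncrement, gaussianReal_map_const_mul, mul_zero]
  congr 1
  ext
  simp [hn']

lemma IsBrownianSheet.isPredictableArray [IsProbabilityMeasure P] (hW : IsBrownianSheet P W)
    {f : ℝ → ℝ} (hf : Measurable f) {C : ℝ} (hfC : ∀ x, |f x| ≤ C) (n : ℕ)
    {c : Fin n × Fin n → ℕ}
    (hc : ∀ p q : Fin n × Fin n, (q.1 : ℕ) < p.1 → (q.2 : ℕ) < p.2 → c q < c p) :
    IsPredictableArray P (fun p => (borel ℝ).comap (cellIncrement W n p.1 p.2)) c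
      (gridWeight W f n) (gridInnovation W n) C innovationBound := by
  have hg : Measurable fun x : ℝ => x ^ 2 - 1 := by fun_prop
  have hm : ∀ p : Fin n × Fin n, Measurable fun ω => (n : ℝ) * cellIncrement W n p.1 p.2 ω :=
    fun p => (measurable_cellIncrement hW n p.1 p.2).const_mul _
  have hint : ∀ (p : Fin n × Fin n) (m : ℕ), ∫ ω, gridInnovation W n p ω ^ m ∂P =
      ∫ x, (x ^ 2 - 1) ^ m ∂gaussianReal 0 1 := fun p m => by
    rw [← hW.map_mul_cellIncrement p, integral_map (hm p).aemeasurable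
      (hg.pow_const m).aestronglyMeasurable]
    rfl
  have hcomap : ∀ p : Fin n × Fin n,
      Measurable[(borel ℝ).comap (cellIncrement W n p.1 p.2)] (cellIncrement W n p.1 p.2) :=
    fun p => by
      rw [← BorelSpace.measurable_eq]
      exact comap_measurable _
  have hmem : MemLp (fun x : ℝ => x ^ 2 - 1) 4 (gaussianReal 0 1) := by
    have h8 : MemLp (fun x : ℝ => x) 8 (gaussianReal 0 1) :=
      memLp_id_gaussianReal' 8 (by norm_num)
    have : ENNReal.HolderTriple 8 8 4 := ⟨by
      rw [← two_mul, show (8 : ENNReal) = 2 * 4 by norm_num,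
        ENNReal.mul_inv (by simp) (by simp), ← mul_assoc,
        ENNReal.mul_inv_cancel (by simp) (by simp), one_mul]⟩
    simp only [sq]
    exact (h8.mul h8 (r := 4)).sub (memLp_const 1)
  refine ⟨fun p => ?_, ?_, fun p => ?_, fun p => ?_, fun p => ?_, fun p => ?_, fun p => ?_,
    fun p => ?_, fun p ω => hfC _⟩
  · rw [← BorelSpace.measurable_eq]
    exact (measurable_cellIncrement hW n p.1 p.2).comap_le
  · have := (hW.iIndepFun_cellIncrement n).iIndep
    rwa [BorelSpace.measurable_eq (α := ℝ)] at this
  · exact (hg.comp ((hcomap p).const_mul (n : ℝ))).stronglyMeasurable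
  · rw [← hW.map_mul_cellIncrement p] at hmem
    exact hmem.comp_of_map (hm p).aemeasurable
  · have h1 := hint p 1
    simp only [pow_one] at h1
    have h2 : Integrable (fun x : ℝ => x ^ 2) (gaussianReal 0 1) :=
      (memLp_id_gaussianReal' 2 (by norm_num)).integrable_sq
    have h3 := variance_fun_id_gaussianReal (μ := 0) (v := 1)
    rw [variance_eq_integral measurable_id'.aemeasurable] at h3
    simp only [integral_id_gaussianReal, sub_zero, NNReal.coe_one] at h3
    rw [h1, integral_sub h2 (integrable_const 1), h3]
    simp
  · exact (hint p 2).trans_le (le_max_left _ _)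
  · exact (hint p 4).trans_le (le_max_right _ _)
  · refine (hf.comp (Finset.measurable_fun_sum _ fun q hq => ?_)).stronglyMeasurable
    have hq' := (Finset.mem_filter.1 hq).2
    exact (hcomap q).mono (le_iSup₂_of_le q (hc p q hq'.1 hq'.2) le_rfl) le_rfl

end GridIncrements

section Oscillation

lemma card_filter_fst_le (n L a : ℕ) :
    (Finset.univ.filter fun p : Fin n × Fin n => a * L ≤ p.1 ∧ (p.1 : ℕ) < (a + 1) * L).card
      ≤ L * n := by
  have h : (Finset.univ.filter fun i : Fin n => a * L ≤ i ∧ (i : ℕ) < (a + 1) * L).card ≤ L := by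
    calc _ ≤ (Finset.Ico (a * L) ((a + 1) * L)).card :=
          Finset.card_le_card_of_injOn Fin.val (fun i hi => by simpa using hi)
            Fin.val_injective.injOn
      _ = L := by rw [Nat.card_Ico, ← Nat.sub_mul, Nat.add_sub_cancel_left, one_mul]
  calc _ ≤ ((Finset.univ.filter fun i : Fin n => a * L ≤ i ∧ (i : ℕ) < (a + 1) * L) ×ˢ
        (Finset.univ : Finset (Fin n))).card := Finset.card_le_card fun p hp => by simpa using hp
    _ ≤ L * n := by
      rw [Finset.card_product, Finset.card_univ, Fintype.card_fin]
      exact Nat.mul_le_mul_right n h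

lemma card_filter_snd_le (n L a : ℕ) :
    (Finset.univ.filter fun p : Fin n × Fin n => a * L ≤ p.2 ∧ (p.2 : ℕ) < (a + 1) * L).card
      ≤ L * n :=
  (Finset.card_le_card_of_injOn Prod.swap (fun p hp => by simpa using hp)
    Prod.swap_injective.injOn).trans (card_filter_fst_le n L a)

lemma floor_mul_lt_floor_mul_add {n : ℕ} {s s' δ : ℝ} (hs' : 0 ≤ s') (h : |s - s'| < δ) :
    ⌊(n : ℝ) * s'⌋₊ < ⌊(n : ℝ) * s⌋₊ + (⌈δ * n⌉₊ + 1) := by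
  have h1 := Nat.floor_le (mul_nonneg (Nat.cast_nonneg (α := ℝ) n) hs')
  have h2 := Nat.lt_floor_add_one ((n : ℝ) * s)
  have h3 := Nat.le_ceil (δ * n)
  have h4 : (n : ℝ) * s' ≤ n * s + δ * n := by
    nlinarith [(abs_lt.1 h).1, Nat.cast_nonneg (α := ℝ) n]
  have : (⌊(n : ℝ) * s'⌋₊ : ℝ) < ⌊(n : ℝ) * s⌋₊ + (⌈δ * n⌉₊ + 1) := by linarith
  exact_mod_cast this

lemma abs_sub_le_of_windows {T : ℕ → ℝ} {L k k' : ℕ} {r : ℝ} {n : ℕ} (hk : k ≤ n) (hk' : k' ≤ n)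
    (h : ∀ k' ≤ n, ∀ k ≤ k', k' < k + L → |T k - T k'| ≤ r) (h1 : k < k' + L) (h2 : k' < k + L) :
    |T k - T k'| ≤ r := by
  rcases le_total k k' with hle | hle
  · exact h k' hk' k hle h2
  · rw [abs_sub_comm]
    exact h k hk k' hle h1

lemma div_add_one_mul_pow_four_le {n : ℕ} {δ : ℝ} (hδ : 0 < δ) (hδ1 : δ ≤ 1) (hn : 2 ≤ δ * n) :
    ((n / (⌈δ * n⌉₊ + 1) + 1 : ℕ) : ℝ) * (((⌈δ * n⌉₊ + 1) * n : ℕ) : ℝ) ^ 2 ≤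
      6 * δ * (n : ℝ) ^ 4 := by
  set L := ⌈δ * n⌉₊ + 1 with hL
  have hL2 : (L : ℝ) ≤ 2 * δ * n := by
    have := Nat.ceil_lt_add_one (show 0 ≤ δ * n by linarith)
    rw [hL]
    push_cast
    linarith
  have h1 : ((n / L : ℕ) : ℝ) * L ≤ n := by exact_mod_cast Nat.div_mul_le_self n L
  have h2 : (((n / L : ℕ) : ℝ) * L) * L + L ^ 2 ≤ 6 * δ * n ^ 2 := by
    have ha : (((n / L : ℕ) : ℝ) * L) * L ≤ n * (2 * δ * n) := by gcongr
    have hb : (L : ℝ) ^ 2 ≤ (2 * δ * n) ^ 2 := by gcongr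
    have hc : (2 * δ * n) ^ 2 ≤ 4 * δ * n ^ 2 := by
      have : δ ^ 2 ≤ δ := by nlinarith
      nlinarith [mul_le_mul_of_nonneg_right this (sq_nonneg (n : ℝ))]
    linarith
  push_cast
  calc (((n / L : ℕ) : ℝ) + 1) * (L * n) ^ 2
      = ((((n / L : ℕ) : ℝ) * L) * L + L ^ 2) * n ^ 2 := by ring
    _ ≤ 6 * δ * n ^ 2 * n ^ 2 := by gcongr
    _ = 6 * δ * (n : ℝ) ^ 4 := by ring

variable {Ω : Type*} [MeasurableSpace Ω] {P : Measure Ω} {W : ℝ × ℝ → Ω → ℝ}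

lemma innovationBound_nonneg : 0 ≤ innovationBound :=
  le_max_of_le_left (integral_nonneg fun _ => sq_nonneg _)

lemma modCont_le_of_gridSum {X : ℝ × ℝ → ℝ} {T : ℕ → ℕ → ℝ} {n : ℕ} {δ ρ : ℝ}
    (hn : 0 < n) (hρ : 0 < ρ)
    (hX : ∀ s ∈ Set.Icc (0 : ℝ) 1, ∀ t ∈ Set.Icc (0 : ℝ) 1,
      X (s, t) = T ⌊(n : ℝ) * s⌋₊ ⌊(n : ℝ) * t⌋₊ / n)
    (h₁ : ∀ l ≤ n, ∀ k' ≤ n, ∀ k ≤ k', k' < k + (⌈δ * n⌉₊ + 1) → |T k l - T k' l| ≤ 3 * (n * ρ))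
    (h₂ : ∀ k ≤ n, ∀ l' ≤ n, ∀ l ≤ l', l' < l + (⌈δ * n⌉₊ + 1) →
      |T k l - T k l'| ≤ 3 * (n * ρ)) :
    modCont X δ ≤ 6 * ρ := by
  have hn' : (0 : ℝ) < n := Nat.cast_pos.2 hn
  refine Real.iSup_le (fun q => ?_) (by positivity)
  obtain ⟨⟨⟨s, t⟩, ⟨s', t'⟩⟩, ⟨hz0, hz1⟩, ⟨hz0', hz1'⟩, hd⟩ := q
  simp only [Prod.mk_le_mk] at hz0 hz1 hz0' hz1'
  have hds := (le_max_left _ _).trans_lt hd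
  have hdt := (le_max_right _ _).trans_lt hd
  simp only at hds hdt
  have hs : s ∈ Set.Icc (0 : ℝ) 1 := ⟨hz0.1, hz1.1⟩
  have ht : t ∈ Set.Icc (0 : ℝ) 1 := ⟨hz0.2, hz1.2⟩
  have hs' : s' ∈ Set.Icc (0 : ℝ) 1 := ⟨hz0'.1, hz1'.1⟩
  have ht' : t' ∈ Set.Icc (0 : ℝ) 1 := ⟨hz0'.2, hz1'.2⟩
  simp only [hX s hs t ht, hX s' hs' t' ht']
  have e1 := abs_sub_le_of_windows (T := fun k => T k ⌊(n : ℝ) * t⌋₊)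
    (floor_mul_le_of_mem_Icc hs) (floor_mul_le_of_mem_Icc hs')
    (h₁ _ (floor_mul_le_of_mem_Icc ht))
    (floor_mul_lt_floor_mul_add hs.1 (by rwa [abs_sub_comm]))
    (floor_mul_lt_floor_mul_add hs'.1 hds)
  have e2 := abs_sub_le_of_windows (T := fun l => T ⌊(n : ℝ) * s'⌋₊ l)
    (floor_mul_le_of_mem_Icc ht) (floor_mul_le_of_mem_Icc ht')
    (h₂ _ (floor_mul_le_of_mem_Icc hs'))
    (floor_mul_lt_floor_mul_add ht.1 (by rwa [abs_sub_comm]))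
    (floor_mul_lt_floor_mul_add ht'.1 hdt)
  rw [← sub_div, abs_div, abs_of_pos hn', div_le_iff₀ hn']
  refine (abs_sub_le _ _ _).trans ((add_le_add e1 e2).trans_eq (by ring))

lemma IsBrownianSheet.measure_le_modCont_wqv [IsProbabilityMeasure P] (hW : IsBrownianSheet P W)
    {f : ℝ → ℝ} (hf : Measurable f) {C : ℝ} (hfC : ∀ x, |f x| ≤ C) {n : ℕ} {δ ρ : ℝ}
    (hδ : 0 < δ) (hδ1 : δ ≤ 1) (hn : 2 ≤ δ * n) (hρ : 0 < ρ) :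
    P {ω | 8 * ρ ≤ modCont (fun z => wqv W f n z.1 z.2 ω) δ} ≤
      ENNReal.ofReal (192 * (C ^ 4 * (8 * innovationBound ^ 2 + 3 * innovationBound)) / ρ ^ 4 * δ)
      := by
  have hn0 : 0 < n := by
    rcases Nat.eq_zero_or_pos n with rfl | h
    · norm_num at hn
    · exact h
  have hn' : (0 : ℝ) < n := Nat.cast_pos.2 hn0
  have hK := innovationBound_nonneg
  set B := C ^ 4 * (8 * innovationBound ^ 2 + 3 * innovationBound) with hB
  have hB0 : 0 ≤ B := by positivity
  have a₁ := hW.isPredictableArray hf hfC n (c := fun p => p.1) fun _ _ h _ => h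
  have a₂ := hW.isPredictableArray hf hfC n (c := fun p => p.2) fun _ _ _ h => h
  have hr : 0 < n * ρ := by positivity
  have m₁ := a₁.measure_exists_lt_abs_sum_sub a₂ (n := n) (Nat.succ_pos ⌈δ * n⌉₊) hK
    (card_filter_fst_le n _) hr
  have m₂ := a₂.measure_exists_lt_abs_sum_sub a₁ (n := n) (Nat.succ_pos ⌈δ * n⌉₊) hK
    (card_filter_snd_le n _) hr
  have hbound : ((n / (⌈δ * n⌉₊ + 1) + 1 : ℕ) : ℝ) *
      (16 * (B * (((⌈δ * n⌉₊ + 1) * n : ℕ) : ℝ) ^ 2) / (n * ρ) ^ 4) ≤ 96 * B / ρ ^ 4 * δ := by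
    calc _ = 16 * B / (n * ρ) ^ 4 * (((n / (⌈δ * n⌉₊ + 1) + 1 : ℕ) : ℝ) *
          (((⌈δ * n⌉₊ + 1) * n : ℕ) : ℝ) ^ 2) := by ring
      _ ≤ 16 * B / (n * ρ) ^ 4 * (6 * δ * (n : ℝ) ^ 4) :=
        mul_le_mul_of_nonneg_left (div_add_one_mul_pow_four_le hδ hδ1 hn) (by positivity)
      _ = 96 * B / ρ ^ 4 * δ := by
        field_simp
        ring
  refine (measure_mono_ae ?_).trans ((measure_union_le _ _).trans
    ((add_le_add (m₁.trans (ENNReal.ofReal_le_ofReal hbound))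
      (m₂.trans (ENNReal.ofReal_le_ofReal hbound))).trans_eq ?_))
  · filter_upwards [hW.ae_wqv_eq f hn0] with ω hω hmod
    by_contra hnot
    have hnot := not_or.1 hnot
    simp only [Set.mem_ofPred_eq, not_exists, not_and, not_lt] at hnot
    have := modCont_le_of_gridSum (X := fun z => wqv W f n z.1 z.2 ω)
      (T := fun k l => gridSum W f n k l ω) hn0 hρ hω hnot.1
      (by simpa only [gridSum, and_comm] using hnot.2)
    have hmod' : 8 * ρ ≤ modCont (fun z => wqv W f n z.1 z.2 ω) δ := hmod
    linarith
  · rw [← ENNReal.ofReal_add (by positivity) (by positivity)]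
    congr 1
    ring

end Oscillation

/-- Tightness estimate for the weighted quadratic variations processes `Xⁿ` in the
two-parameter Skorohod space: for every `ε > 0`,
`lim_{δ→0} limsup_{n→∞} P[w(Xⁿ,δ) ≥ ε] = 0`. -/
theorem wqv_tightness
    {Ω : Type*} [MeasurableSpace Ω] (P : Measure Ω) [IsProbabilityMeasure P]
    (W : ℝ × ℝ → Ω → ℝ) (hW : IsBrownianSheet P W)
    (f : ℝ → ℝ) (hf : Measurable f) (C : ℝ) (hfC : ∀ x, |f x| ≤ C) :
    ∀ ε : ℝ, 0 < ε →
      Tendsto (fun δ : ℝ =>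
          Filter.limsup (fun n : ℕ =>
            P {ω | ε ≤ modCont (fun z => wqv W f n z.1 z.2 ω) δ}) atTop)
        (𝓝[>] (0:ℝ)) (𝓝 (0 : ENNReal)) := by
  intro ε hε
  have hρ : 0 < ε / 8 := by positivity
  set D := 192 * (C ^ 4 * (8 * innovationBound ^ 2 + 3 * innovationBound)) / (ε / 8) ^ 4 with hD
  have hlim : Tendsto (fun δ : ℝ => ENNReal.ofReal (D * δ)) (𝓝[>] 0) (𝓝 0) := by
    have h : Tendsto (fun δ : ℝ => ENNReal.ofReal (D * δ)) (𝓝 0) (𝓝 (ENNReal.ofReal (D * 0))) :=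
      ENNReal.tendsto_ofReal (tendsto_id.const_mul D)
    rw [mul_zero, ENNReal.ofReal_zero] at h
    exact h.mono_left nhdsWithin_le_nhds
  refine tendsto_of_tendsto_of_tendsto_of_le_of_le' tendsto_const_nhds hlim
    (Eventually.of_forall fun _ => zero_le) ?_
  filter_upwards [Ioc_mem_nhdsGT (zero_lt_one' ℝ)] with δ hδ
  refine limsup_le_of_le (by isBoundedDefault) ?_
  filter_upwards [tendsto_natCast_atTop_atTop.eventually_ge_atTop (2 / δ)] with n hn
  have := hW.measure_le_modCont_wqv hf hfC hδ.1 hδ.2 ((div_le_iff₀' hδ.1).1 hn) hρ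
  rwa [mul_div_cancel₀ ε (by norm_num : (8 : ℝ) ≠ 0)] at this
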